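/- Fix s > 0 and t > 0, and set ψ_t(+∞) = √(2 Σ_{k ∈ ℤ} 2^{k} e^{−2t·2^{ks}}). Then the family of d_t-balls B_t(x,r) = {y ∈ ℝ⁺ : d_t(x,y) < r} with x ∈ ℝ⁺ and 0 < r < ψ_t(+∞) coincides with the family 𝒟 of all dyadic intervals: every such ball B_t(x,r) equals the largest dyadic interval I containing x with ψ_t(|I|) < r, and conversely every dyadic interval I ∈ 𝒟 equals B_t(x,r) for any x ∈ I and suitable r > 0. -/

import Mathlib

open Real Set

/-- The dyadic interval `I^j_k = [k 2^{-j}, (k+1) 2^{-j}) ⊂ ℝ⁺`, `j ∈ ℤ`, `k ∈ ℕ₀`. -/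
def dyadicI (j : ℤ) (k : ℕ) : Set ℝ :=
  Set.Ico ((k : ℝ) * (2 : ℝ) ^ (-j)) (((k : ℝ) + 1) * (2 : ℝ) ^ (-j))

/-- The mother Haar wavelet `h = χ_{[0,1/2)} - χ_{[1/2,1)}`. -/
noncomputable def motherHaar (x : ℝ) : ℝ :=
  if 0 ≤ x ∧ x < 1 / 2 then 1 else if 1 / 2 ≤ x ∧ x < 1 then -1 else 0

/-- The Haar wavelet `h^j_k(x) = 2^{j/2} h(2^j x - k)`, supported on `I^j_k`. -/
noncomputable def haarFn (j : ℤ) (k : ℕ) (x : ℝ) : ℝ :=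
  (2 : ℝ) ^ ((j : ℝ) / 2) * motherHaar ((2 : ℝ) ^ j * x - (k : ℝ))

/-- The fractional dyadic diffusion distance
`d_t(x,y) = (Σ_h e^{-2t|I(h)|^{-s}} |h(x) - h(y)|²)^{1/2}`. -/
noncomputable def dyadicDt (s t x y : ℝ) : ℝ :=
  Real.sqrt (∑' p : ℤ × ℕ,
    Real.exp (-2 * t * ((2 : ℝ) ^ (-p.1)) ^ (-s)) * (haarFn p.1 p.2 x - haarFn p.1 p.2 y) ^ 2)

/-- `η_t(σ) = 2 e^{-2tσ} + Σ_{ℓ≥1} 2^ℓ e^{-2t 2^{sℓ} σ}`. -/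
noncomputable def etaFn (s t σ : ℝ) : ℝ :=
  2 * Real.exp (-2 * t * σ) +
    ∑' l : ℕ, (2 : ℝ) ^ (l + 1) * Real.exp (-2 * t * (2 : ℝ) ^ (s * ((l : ℝ) + 1)) * σ)

/-- `ψ_t(λ) = √((2/λ) η_t(λ^{-s}))`. -/
noncomputable def psiFn (s t lam : ℝ) : ℝ :=
  Real.sqrt ((2 / lam) * etaFn s t (lam ^ (-s)))

/-- `ψ_t(+∞) = √(2 Σ_{k ∈ ℤ} 2^k e^{-2t 2^{ks}})`. -/
noncomputable def psiInf (s t : ℝ) : ℝ :=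
  Real.sqrt (2 * ∑' k : ℤ, (2 : ℝ) ^ k * Real.exp (-2 * t * (2 : ℝ) ^ ((k : ℝ) * s)))

/-- The level-`j` index of `x`: for `0 ≤ x`, the unique `k` with `x ∈ dyadicI j k`. -/
noncomputable def dyadicIndex (j : ℤ) (x : ℝ) : ℕ := ⌊(2 : ℝ) ^ j * x⌋₊

lemma mem_dyadicI_iff (j : ℤ) (k : ℕ) (x : ℝ) :
    x ∈ dyadicI j k ↔ 0 ≤ x ∧ dyadicIndex j x = k := by
  have h2 : (0 : ℝ) < 2 ^ j := by positivity
  simp only [dyadicI, Set.mem_Ico, dyadicIndex, zpow_neg, ← div_eq_mul_inv, div_le_iff₀ h2,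
    lt_div_iff₀ h2, mul_comm x]
  constructor
  · rintro ⟨h, h'⟩
    have h0 : 0 ≤ (2 : ℝ) ^ j * x := le_trans (Nat.cast_nonneg k) h
    exact ⟨nonneg_of_mul_nonneg_right h0 h2, (Nat.floor_eq_iff h0).2 ⟨h, h'⟩⟩
  · rintro ⟨h, h'⟩
    exact (Nat.floor_eq_iff (by positivity)).1 h'

lemma dyadicIndex_succ_div_two (j : ℤ) (x : ℝ) : dyadicIndex (j + 1) x / 2 = dyadicIndex j x := by
  rw [dyadicIndex, ← Nat.floor_div_ofNat, dyadicIndex, zpow_add_one₀ two_ne_zero]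
  congr 1
  ring

lemma dyadicIndex_eq_of_le {i j : ℤ} (hij : i ≤ j) {x y : ℝ}
    (h : dyadicIndex j x = dyadicIndex j y) : dyadicIndex i x = dyadicIndex i y := by
  induction i, hij using Int.leInductionDown with
  | base => exact h
  | pred n _ ih =>
    rw [← dyadicIndex_succ_div_two (n - 1) x, ← dyadicIndex_succ_div_two (n - 1) y]
    simp [ih]

/-- Two distinct points have the same index at level `i` exactly up to some last level `j`, and
`2^{-j}` is then the length of the smallest dyadic interval containing both. -/
lemma exists_last_common_dyadicIndex {x y : ℝ} (hx : 0 ≤ x) (hy : 0 ≤ y) (hxy : x ≠ y) :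
    ∃ j : ℤ, ∀ i, dyadicIndex i x = dyadicIndex i y ↔ i ≤ j := by
  have hbdd : ∃ b : ℤ, ∀ z : ℤ, dyadicIndex z x = dyadicIndex z y → z ≤ b := by
    obtain ⟨n, hn⟩ := pow_unbounded_of_one_lt (1 / |x - y|) (one_lt_two (α := ℝ))
    refine ⟨n, fun z hz => ?_⟩
    by_contra! hlt
    have h := dyadicIndex_eq_of_le hlt.le hz
    have hd : 0 < |x - y| := abs_pos.2 (sub_ne_zero.2 hxy)
    rw [div_lt_iff₀ hd, ← zpow_natCast] at hn
    have hp : (0 : ℝ) < 2 ^ (n : ℤ) := by positivity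
    have a1 := (Nat.floor_eq_iff (a := (2 : ℝ) ^ (n : ℤ) * x) (by positivity)).1 h
    have a2 := (Nat.floor_eq_iff (a := (2 : ℝ) ^ (n : ℤ) * y)
      (n := dyadicIndex n y) (by positivity)).1 rfl
    have : |(2 : ℝ) ^ (n : ℤ) * (x - y)| < 1 := by
      rw [abs_lt]
      constructor <;> nlinarith [a1.1, a1.2, a2.1, a2.2]
    rw [abs_mul, abs_of_pos hp] at this
    linarith
  have hne : ∃ z : ℤ, dyadicIndex z x = dyadicIndex z y := by
    obtain ⟨n, hn⟩ := pow_unbounded_of_one_lt (max x y) (one_lt_two (α := ℝ))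
    have key : ∀ w : ℝ, w ≤ max x y → dyadicIndex (-(n : ℤ)) w = 0 := by
      intro w hw
      rw [dyadicIndex, Nat.floor_eq_zero, zpow_neg, zpow_natCast, inv_mul_lt_one₀ (by positivity)]
      exact hw.trans_lt hn
    exact ⟨-(n : ℤ), by rw [key x (le_max_left _ _), key y (le_max_right _ _)]⟩
  obtain ⟨j, hj, hmax⟩ := Int.exists_greatest_of_bdd hbdd hne
  exact ⟨j, fun i => ⟨hmax i, fun hi => dyadicIndex_eq_of_le hi hj⟩⟩

lemma haarFn_eq_ite (j : ℤ) (k : ℕ) {x : ℝ} (hx : 0 ≤ x) :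
    haarFn j k x = if k = dyadicIndex j x then
      (2 : ℝ) ^ ((j : ℝ) / 2) * (if dyadicIndex (j + 1) x = 2 * dyadicIndex j x then 1 else -1)
      else 0 := by
  have hz : 0 ≤ (2 : ℝ) ^ j * x := by positivity
  have hz' : 0 ≤ (2 : ℝ) ^ (j + 1) * x := by positivity
  have hk : k = dyadicIndex j x ↔ (k : ℝ) ≤ 2 ^ j * x ∧ (2 : ℝ) ^ j * x < k + 1 := by
    rw [eq_comm]
    exact Nat.floor_eq_iff hz
  split_ifs with h1 h2
  · have h3 := (Nat.floor_eq_iff hz').1 h2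
    have h4 := hk.1 h1
    rw [← h1, zpow_add_one₀ two_ne_zero] at h3
    push_cast at h3
    rw [haarFn, motherHaar, if_pos ⟨by linarith, by linarith⟩]
  · have h4 := hk.1 h1
    have h5 : ¬ ((2 : ℝ) ^ j * x - k < 1 / 2) := fun h => h2 <| by
      refine (Nat.floor_eq_iff hz').2 ?_
      rw [← h1, zpow_add_one₀ two_ne_zero]
      push_cast
      constructor <;> linarith
    rw [haarFn, motherHaar, if_neg (fun h => h5 h.2),
      if_pos ⟨by linarith, by linarith⟩]
  · rw [hk] at h1
    rw [haarFn, motherHaar, if_neg, if_neg, mul_zero]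
    · exact fun h => h1 ⟨by linarith, by linarith⟩
    · exact fun h => h1 ⟨by linarith, by linarith⟩

/-- The sum over `k` of `|h^i_k(x) - h^i_k(y)|²`, where `2^{-j}` is the dyadic distance of
`x` and `y`, is `2^{i+1}` times this weight. -/
def scaleWeight (j i : ℤ) : ℝ := if i < j then 0 else if i = j then 2 else 1

lemma hasSum_haarFn_sub_sq {x y : ℝ} (hx : 0 ≤ x) (hy : 0 ≤ y) {j : ℤ}
    (hj : ∀ i, dyadicIndex i x = dyadicIndex i y ↔ i ≤ j) (i : ℤ) :
    HasSum (fun k : ℕ => (haarFn i k x - haarFn i k y) ^ 2) (2 * (scaleWeight j i * 2 ^ i)) := by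
  have hsq : ((2 : ℝ) ^ ((i : ℝ) / 2)) ^ 2 = 2 ^ i := by
    rw [← Real.rpow_natCast, ← Real.rpow_mul zero_le_two, ← Real.rpow_intCast]
    norm_num
  simp only [haarFn_eq_ite i _ hx, haarFn_eq_ite i _ hy]
  have hi := hj i
  have hi1 := hj (i + 1)
  have dx := dyadicIndex_succ_div_two i x
  have dy := dyadicIndex_succ_div_two i y
  generalize dyadicIndex i x = m at *
  generalize dyadicIndex i y = n at *
  generalize dyadicIndex (i + 1) x = m' at *
  generalize dyadicIndex (i + 1) y = n' at *
  by_cases hmn : m = n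
  · subst hmn
    have hle : i ≤ j := hi.1 rfl
    convert hasSum_single (f := fun k : ℕ =>
      ((if k = m then (2 : ℝ) ^ ((i : ℝ) / 2) * (if m' = 2 * m then 1 else -1) else 0) -
      (if k = m then (2 : ℝ) ^ ((i : ℝ) / 2) * (if n' = 2 * m then 1 else -1) else 0)) ^ 2)
      m (fun k hk => by simp [hk]) using 1
    simp only [if_true, ← mul_sub, mul_pow, hsq, scaleWeight]
    rcases hle.lt_or_eq with hlt | rfl
    · have : m' = n' := hi1.2 (by omega)
      simp [hlt, this]
    · have : m' ≠ n' := fun h => by have := hi1.1 h; omega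
      have h12 : (m' = 2 * m ∧ ¬ n' = 2 * m) ∨ (¬ m' = 2 * m ∧ n' = 2 * m) := by omega
      rcases h12 with ⟨h1, h2⟩ | ⟨h1, h2⟩ <;> simp only [if_pos, lt_irrefl, h1, h2, if_false] <;> norm_num <;> ring
  · have hlt : j < i := by
      by_contra! h
      exact hmn (hi.2 h)
    convert hasSum_sum_of_ne_finset_zero (s := {m, n}) (L := .unconditional ℕ) (f := fun k : ℕ =>
      ((if k = m then (2 : ℝ) ^ ((i : ℝ) / 2) * (if m' = 2 * m then 1 else -1) else 0) -
      (if k = n then (2 : ℝ) ^ ((i : ℝ) / 2) * (if n' = 2 * n then 1 else -1) else 0)) ^ 2)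
      (fun k hk => by
        simp only [Finset.mem_insert, Finset.mem_singleton, not_or] at hk
        simp [hk]) using 1
    rw [Finset.sum_pair hmn]
    simp only [if_true, if_neg hmn, if_neg (Ne.symm hmn), sub_zero, zero_sub, neg_sq, mul_pow, hsq,
      scaleWeight, if_neg hlt.not_gt, if_neg hlt.ne']
    split_ifs <;> ring

/-- The energy `2^i e^{-2t 2^{is}}` of the scale `i`. -/
noncomputable def scaleEnergy (s t : ℝ) (i : ℤ) : ℝ :=
  (2 : ℝ) ^ i * Real.exp (-2 * t * (2 : ℝ) ^ ((i : ℝ) * s))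

lemma scaleEnergy_pos (s t : ℝ) (i : ℤ) : 0 < scaleEnergy s t i := by
  unfold scaleEnergy
  positivity

lemma scaleEnergy_neg_le {s t : ℝ} (ht : 0 < t) (n : ℕ) :
    scaleEnergy s t (-(n : ℤ)) ≤ (1 / 2) ^ n := by
  rw [scaleEnergy, zpow_neg, zpow_natCast, one_div, inv_pow]
  refine mul_le_of_le_one_right (by positivity) (Real.exp_le_one_iff.2 ?_)
  have : 0 ≤ t * (2 : ℝ) ^ ((((-(n : ℤ)) : ℤ) : ℝ) * s) := by positivity
  linarith

lemma exists_scaleEnergy_le {s t : ℝ} (hs : 0 < s) (ht : 0 < t) :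
    ∃ C : ℝ, ∀ n : ℕ, scaleEnergy s t (n : ℤ) ≤ C * (1 / 2) ^ n := by
  obtain ⟨N, hN⟩ := exists_nat_ge (2 / s)
  rw [div_le_iff₀ hs] at hN
  refine ⟨N.factorial / (2 * t) ^ N, fun n => ?_⟩
  set u : ℝ := (2 : ℝ) ^ ((n : ℝ) * s) with hu
  have hu0 : 0 < u := by positivity
  have huN : (4 : ℝ) ^ n ≤ u ^ N := by
    rw [hu, ← Real.rpow_natCast, ← Real.rpow_natCast, ← Real.rpow_mul zero_le_two,
      show (4 : ℝ) = 2 ^ (2 : ℝ) by norm_num, ← Real.rpow_mul zero_le_two]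
    refine Real.rpow_le_rpow_of_exponent_le one_le_two ?_
    have : (0 : ℝ) ≤ n := Nat.cast_nonneg n
    nlinarith
  have hexp := Real.pow_div_factorial_le_exp (x := 2 * t * u) (by positivity) N
  have hf : (0 : ℝ) < N.factorial := by positivity
  have htN : (0 : ℝ) < (2 * t) ^ N := by positivity
  have hE : scaleEnergy s t (n : ℤ) = 2 ^ n / Real.exp (2 * t * u) := by
    rw [scaleEnergy, zpow_natCast, Int.cast_natCast, ← hu, div_eq_mul_inv, ← Real.exp_neg]
    ring_nf
  have h42 : (4 : ℝ) ^ n = 2 ^ n * 2 ^ n := by rw [← mul_pow]; norm_num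
  rw [hE, div_le_iff₀ (Real.exp_pos _)]
  calc (2 : ℝ) ^ n = N.factorial / (2 * t) ^ N * (1 / 2) ^ n *
        ((2 * t) ^ N * 4 ^ n / N.factorial) := by
        rw [h42, one_div, inv_pow]; field_simp
    _ ≤ N.factorial / (2 * t) ^ N * (1 / 2) ^ n * ((2 * t * u) ^ N / N.factorial) := by
        rw [mul_pow (2 * t) u]; gcongr
    _ ≤ _ := by gcongr

lemma summable_scaleEnergy {s t : ℝ} (hs : 0 < s) (ht : 0 < t) : Summable (scaleEnergy s t) := by
  obtain ⟨C, hC⟩ := exists_scaleEnergy_le hs ht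
  have hg : Summable fun n : ℕ => (1 / 2 : ℝ) ^ n := summable_geometric_two
  exact Summable.of_nat_of_neg
    (.of_nonneg_of_le (fun n => (scaleEnergy_pos s t n).le) hC (hg.mul_left C))
    (.of_nonneg_of_le (fun n => (scaleEnergy_pos s t _).le) (scaleEnergy_neg_le ht) hg)

/-- Half the squared diffusion distance of two points at dyadic distance `2^{-j}`. -/
noncomputable def diffusionEnergy (s t : ℝ) (j : ℤ) : ℝ :=
  ∑' i : ℤ, scaleWeight j i * scaleEnergy s t i

lemma scaleWeight_nonneg (j i : ℤ) : 0 ≤ scaleWeight j i := by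
  unfold scaleWeight
  split_ifs <;> norm_num

lemma scaleWeight_le_two (j i : ℤ) : scaleWeight j i ≤ 2 := by
  unfold scaleWeight
  split_ifs <;> norm_num

lemma norm_scaleWeight_mul_scaleEnergy_le (s t : ℝ) (j i : ℤ) :
    ‖scaleWeight j i * scaleEnergy s t i‖ ≤ 2 * scaleEnergy s t i := by
  rw [Real.norm_of_nonneg (mul_nonneg (scaleWeight_nonneg j i) (scaleEnergy_pos s t i).le)]
  exact mul_le_mul_of_nonneg_right (scaleWeight_le_two j i) (scaleEnergy_pos s t i).le

lemma summable_scaleWeight_mul_scaleEnergy {s t : ℝ} (hs : 0 < s) (ht : 0 < t) (j : ℤ) :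
    Summable fun i => scaleWeight j i * scaleEnergy s t i :=
  .of_norm_bounded ((summable_scaleEnergy hs ht).mul_left 2)
    (norm_scaleWeight_mul_scaleEnergy_le s t j)

lemma scaleEnergy_tail_summable {s t : ℝ} (hs : 0 < s) (ht : 0 < t) (j : ℤ) :
    Summable fun n : ℕ => scaleEnergy s t (j + n) :=
  (summable_scaleEnergy hs ht).comp_injective fun a b h => by simpa using h

lemma diffusionEnergy_eq_add_tsum_tail {s t : ℝ} (hs : 0 < s) (ht : 0 < t) (j : ℤ) :
    diffusionEnergy s t j =
      2 * scaleEnergy s t j + ∑' n : ℕ, scaleEnergy s t (j + 1 + n) := by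
  have hinj : Function.Injective fun n : ℕ => j + (n : ℤ) := fun a b h => by simpa using h
  have hsupp : Function.support (fun i => scaleWeight j i * scaleEnergy s t i) ⊆
      Set.range fun n : ℕ => j + (n : ℤ) := by
    intro i hi
    have : j ≤ i := by
      by_contra! h
      exact hi (by simp [scaleWeight, h])
    exact ⟨(i - j).toNat, by simp; omega⟩
  have hsum := (summable_scaleWeight_mul_scaleEnergy hs ht j).comp_injective hinj
  have hlt : ∀ n : ℕ, ¬ j + ((n : ℤ) + 1) < j := fun n => by omega
  have hne : ∀ n : ℕ, j + ((n : ℤ) + 1) ≠ j := fun n => by omega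
  rw [diffusionEnergy, ← hinj.tsum_eq hsupp, show ∑' n : ℕ, scaleWeight j (j + n) * scaleEnergy s t (j + n) = _ from
    hsum.tsum_eq_zero_add]
  congr 1
  · simp [scaleWeight]
  · refine tsum_congr fun n => ?_
    simp [scaleWeight, hlt, hne, add_assoc, add_comm (1 : ℤ)]

lemma strictAnti_diffusionEnergy {s t : ℝ} (hs : 0 < s) (ht : 0 < t) :
    StrictAnti (diffusionEnergy s t) := by
  refine strictAnti_int_of_succ_lt fun j => ?_
  have hlt : scaleEnergy s t (j + 1) < 2 * scaleEnergy s t j := by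
    have : (2 : ℝ) ^ ((j : ℝ) * s) < 2 ^ (((j + 1 : ℤ) : ℝ) * s) :=
      Real.rpow_lt_rpow_of_exponent_lt one_lt_two (by push_cast; linarith)
    have hexp : Real.exp (-2 * t * (2 : ℝ) ^ (((j + 1 : ℤ) : ℝ) * s)) <
        Real.exp (-2 * t * (2 : ℝ) ^ ((j : ℝ) * s)) := Real.exp_lt_exp.2 (by nlinarith)
    have hp : (0 : ℝ) < 2 ^ j := by positivity
    rw [scaleEnergy, scaleEnergy, zpow_add_one₀ two_ne_zero]
    nlinarith
  have htail := (scaleEnergy_tail_summable hs ht (j + 1)).tsum_eq_zero_add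
  rw [diffusionEnergy_eq_add_tsum_tail hs ht, diffusionEnergy_eq_add_tsum_tail hs ht, htail]
  have : ∑' n : ℕ, scaleEnergy s t (j + 1 + ((n + 1 : ℕ) : ℤ)) =
      ∑' n : ℕ, scaleEnergy s t (j + 1 + 1 + n) :=
    tsum_congr fun n => by congr 1; push_cast; ring
  rw [this]
  simp only [Nat.cast_zero, add_zero]
  linarith

open Filter Topology in
lemma tendsto_diffusionEnergy_atTop {s t : ℝ} (hs : 0 < s) (ht : 0 < t) :
    Tendsto (diffusionEnergy s t) atTop (𝓝 0) := by
  rw [← tsum_zero (β := ℤ)]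
  refine tendsto_tsum_of_dominated_convergence ((summable_scaleEnergy hs ht).mul_left 2)
    (fun i => ?_) (.of_forall fun j => norm_scaleWeight_mul_scaleEnergy_le s t j)
  refine tendsto_const_nhds.congr' ?_
  filter_upwards [eventually_gt_atTop i] with j hj
  simp [scaleWeight, hj]

open Filter Topology in
lemma tendsto_diffusionEnergy_atBot {s t : ℝ} (hs : 0 < s) (ht : 0 < t) :
    Tendsto (diffusionEnergy s t) atBot (𝓝 (∑' i, scaleEnergy s t i)) := by
  refine tendsto_tsum_of_dominated_convergence ((summable_scaleEnergy hs ht).mul_left 2)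
    (fun i => ?_) (.of_forall fun j => norm_scaleWeight_mul_scaleEnergy_le s t j)
  refine tendsto_const_nhds.congr' ?_
  filter_upwards [eventually_lt_atBot i] with j hj
  simp [scaleWeight, hj.not_gt, hj.ne']

lemma diffusionEnergy_pos {s t : ℝ} (hs : 0 < s) (ht : 0 < t) (j : ℤ) :
    0 < diffusionEnergy s t j := by
  rw [diffusionEnergy_eq_add_tsum_tail hs ht]
  have := scaleEnergy_pos s t j
  have : 0 ≤ ∑' n : ℕ, scaleEnergy s t (j + 1 + n) :=
    tsum_nonneg fun n => (scaleEnergy_pos s t _).le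
  positivity

lemma two_zpow_neg_rpow_neg (s : ℝ) (i : ℤ) :
    ((2 : ℝ) ^ (-i)) ^ (-s) = (2 : ℝ) ^ ((i : ℝ) * s) := by
  rw [← Real.rpow_intCast, ← Real.rpow_mul zero_le_two]
  push_cast
  ring_nf

lemma psiFn_two_zpow {s t : ℝ} (hs : 0 < s) (ht : 0 < t) (j : ℤ) :
    psiFn s t ((2 : ℝ) ^ (-j)) = Real.sqrt (2 * diffusionEnergy s t j) := by
  rw [psiFn, diffusionEnergy_eq_add_tsum_tail hs ht, etaFn, two_zpow_neg_rpow_neg]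
  congr 1
  rw [zpow_neg, div_inv_eq_mul, mul_assoc, mul_add, ← tsum_mul_left]
  congr 2
  · rw [scaleEnergy]
    ring
  · refine tsum_congr fun l => ?_
    have h1 : (2 : ℝ) ^ (j + 1 + (l : ℤ)) = 2 ^ j * 2 ^ (l + 1) := by
      rw [add_assoc, zpow_add₀ two_ne_zero, add_comm 1 (l : ℤ)]
      norm_cast
    have h2 : (2 : ℝ) ^ (((j + 1 + (l : ℤ) : ℤ) : ℝ) * s) =
        2 ^ (s * ((l : ℝ) + 1)) * 2 ^ ((j : ℝ) * s) := by
      rw [← Real.rpow_add two_pos]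
      push_cast
      ring_nf
    rw [scaleEnergy, h1, h2]
    ring_nf

lemma dyadicDt_eq_psiFn {s t : ℝ} (hs : 0 < s) (ht : 0 < t) {x y : ℝ} (hx : 0 ≤ x) (hy : 0 ≤ y)
    {j : ℤ} (hj : ∀ i, dyadicIndex i x = dyadicIndex i y ↔ i ≤ j) :
    dyadicDt s t x y = psiFn s t ((2 : ℝ) ^ (-j)) := by
  have hinner : ∀ i : ℤ, HasSum (fun k : ℕ => Real.exp (-2 * t * ((2 : ℝ) ^ (-i)) ^ (-s)) *
      (haarFn i k x - haarFn i k y) ^ 2) (2 * (scaleWeight j i * scaleEnergy s t i)) := by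
    intro i
    have hvalue : 2 * (scaleWeight j i * scaleEnergy s t i) =
        Real.exp (-2 * t * ((2 : ℝ) ^ (-i)) ^ (-s)) * (2 * (scaleWeight j i * 2 ^ i)) := by
      rw [two_zpow_neg_rpow_neg, scaleEnergy]
      ring
    rw [hvalue]
    exact (hasSum_haarFn_sub_sq hx hy hj i).mul_left _
  have hsum : Summable fun p : ℤ × ℕ => Real.exp (-2 * t * ((2 : ℝ) ^ (-p.1)) ^ (-s)) *
      (haarFn p.1 p.2 x - haarFn p.1 p.2 y) ^ 2 := by
    refine (summable_prod_of_nonneg fun p => by positivity).2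
      ⟨fun i => (hinner i).summable, ?_⟩
    simp only [(hinner _).tsum_eq]
    exact (summable_scaleWeight_mul_scaleEnergy hs ht j).mul_left 2
  rw [dyadicDt, psiFn_two_zpow hs ht, hsum.tsum_prod]
  simp only [(hinner _).tsum_eq, tsum_mul_left, diffusionEnergy]

lemma strictAnti_psiFn_two_zpow {s t : ℝ} (hs : 0 < s) (ht : 0 < t) :
    StrictAnti fun j : ℤ => psiFn s t ((2 : ℝ) ^ (-j)) := by
  intro i j hij
  simp only [psiFn_two_zpow hs ht]
  have := strictAnti_diffusionEnergy hs ht hij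
  exact Real.sqrt_lt_sqrt (mul_nonneg zero_le_two (diffusionEnergy_pos hs ht j).le) (by linarith)

open Filter Topology in
lemma tendsto_psiFn_two_zpow_atTop {s t : ℝ} (hs : 0 < s) (ht : 0 < t) :
    Tendsto (fun j : ℤ => psiFn s t ((2 : ℝ) ^ (-j))) atTop (𝓝 0) := by
  simp only [psiFn_two_zpow hs ht]
  simpa using ((tendsto_diffusionEnergy_atTop hs ht).const_mul 2).sqrt

open Filter Topology in
lemma tendsto_psiFn_two_zpow_atBot {s t : ℝ} (hs : 0 < s) (ht : 0 < t) :
    Tendsto (fun j : ℤ => psiFn s t ((2 : ℝ) ^ (-j))) atBot (𝓝 (psiInf s t)) := by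
  simp only [psiFn_two_zpow hs ht]
  exact ((tendsto_diffusionEnergy_atBot hs ht).const_mul 2).sqrt

lemma psiFn_two_zpow_pos {s t : ℝ} (hs : 0 < s) (ht : 0 < t) (j : ℤ) :
    0 < psiFn s t ((2 : ℝ) ^ (-j)) := by
  rw [psiFn_two_zpow hs ht]
  exact Real.sqrt_pos.2 (mul_pos two_pos (diffusionEnergy_pos hs ht j))

lemma psiFn_two_zpow_lt_psiInf {s t : ℝ} (hs : 0 < s) (ht : 0 < t) (j : ℤ) :
    psiFn s t ((2 : ℝ) ^ (-j)) < psiInf s t :=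
  ((strictAnti_psiFn_two_zpow hs ht) (sub_one_lt j)).trans_le
    ((strictAnti_psiFn_two_zpow hs ht).antitone.ge_of_tendsto
      (tendsto_psiFn_two_zpow_atBot hs ht) (j - 1))

lemma dyadicDt_self (s t x : ℝ) : dyadicDt s t x x = 0 := by simp [dyadicDt]

/-- If `2^{-j}` is the largest dyadic length with `ψ_t(2^{-j}) < r`, the `d_t`-ball of radius `r`
about a point is the dyadic interval of length `2^{-j}` containing it. -/
lemma dyadicDt_ball_eq_dyadicI {s t : ℝ} (hs : 0 < s) (ht : 0 < t) {j : ℤ} {r : ℝ}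
    (hr : ∀ i : ℤ, psiFn s t ((2 : ℝ) ^ (-i)) < r ↔ j ≤ i) {x : ℝ} (hx : 0 ≤ x) :
    {y ∈ Set.Ici (0 : ℝ) | dyadicDt s t x y < r} = dyadicI j (dyadicIndex j x) := by
  ext y
  simp only [Set.mem_ofPred_eq, Set.mem_Ici, mem_dyadicI_iff]
  refine and_congr_right fun hy => ?_
  by_cases hxy : x = y
  · subst hxy
    simpa [dyadicDt_self] using (psiFn_two_zpow_pos hs ht j).trans ((hr j).2 le_rfl)
  · obtain ⟨m, hm⟩ := exists_last_common_dyadicIndex hx hy hxy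
    rw [dyadicDt_eq_psiFn hs ht hx hy hm, hr, ← hm, eq_comm]

/-- The family of `d_t`-balls `B_t(x,r)` with `x ∈ ℝ⁺` and `0 < r < ψ_t(+∞)` coincides with the
family of all dyadic intervals: every such ball is the largest dyadic interval `I ∋ x` with
`ψ_t(|I|) < r`, and conversely every dyadic interval is a `d_t`-ball around any of its points. -/
theorem dyadicDt_balls_eq_dyadic_intervals (s t : ℝ) (hs : 0 < s) (ht : 0 < t) :
    (∀ x ∈ Set.Ici (0 : ℝ), ∀ r : ℝ, 0 < r → r < psiInf s t →
      ∃ (j : ℤ) (k : ℕ), x ∈ dyadicI j k ∧ psiFn s t ((2 : ℝ) ^ (-j)) < r ∧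
        (∀ (j' : ℤ) (k' : ℕ), x ∈ dyadicI j' k' → psiFn s t ((2 : ℝ) ^ (-j')) < r →
          dyadicI j' k' ⊆ dyadicI j k) ∧
        {y ∈ Set.Ici (0 : ℝ) | dyadicDt s t x y < r} = dyadicI j k) ∧
    (∀ (j : ℤ) (k : ℕ), ∀ x ∈ dyadicI j k, ∃ r : ℝ, 0 < r ∧ r < psiInf s t ∧
      {y ∈ Set.Ici (0 : ℝ) | dyadicDt s t x y < r} = dyadicI j k) := by
  have hanti := strictAnti_psiFn_two_zpow hs ht
  constructor
  · intro x hx r hr0 hr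
    obtain ⟨b, hb⟩ := Filter.eventually_atBot.1
      ((tendsto_psiFn_two_zpow_atBot hs ht).eventually_const_lt hr)
    obtain ⟨j, hj, hleast⟩ := Int.exists_least_of_bdd
      (P := fun i : ℤ => psiFn s t ((2 : ℝ) ^ (-i)) < r)
      ⟨b, fun z hz => le_of_not_ge fun h => (hb z h).not_gt hz⟩
      ((tendsto_psiFn_two_zpow_atTop hs ht).eventually_lt_const hr0).exists
    have hiff : ∀ i : ℤ, psiFn s t ((2 : ℝ) ^ (-i)) < r ↔ j ≤ i := fun i =>
      ⟨hleast i, fun h => (hanti.antitone h).trans_lt hj⟩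
    refine ⟨j, dyadicIndex j x, (mem_dyadicI_iff _ _ _).2 ⟨hx, rfl⟩, hj, ?_,
      dyadicDt_ball_eq_dyadicI hs ht hiff hx⟩
    intro j' k' hxk hj' y hyk
    rw [mem_dyadicI_iff] at *
    exact ⟨hyk.1, dyadicIndex_eq_of_le (hleast j' hj') (hyk.2.trans hxk.2.symm)⟩
  · intro j k x hxk
    obtain ⟨hx, rfl⟩ := (mem_dyadicI_iff j k x).1 hxk
    refine ⟨psiFn s t ((2 : ℝ) ^ (-(j - 1))), psiFn_two_zpow_pos hs ht _,
      psiFn_two_zpow_lt_psiInf hs ht _, dyadicDt_ball_eq_dyadicI hs ht (fun i => ?_) hx⟩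
    exact hanti.lt_iff_gt.trans Int.sub_one_lt_iff
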